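/- arXiv:1207.1994 — 14 statements merged into one kernel-verified Lean document; each statement's English description precedes it below -/
import Mathlib

section
/- Let R be a commutative ring, E an R-module and [·,·] : E × E → E an R-bilinear map. For an R-linear endomorphism I of E define the deformed bracket [x,y]_I := [Ix,y] + [x,Iy] − I[x,y], the twice-deformed bracket [x,y]_{I,J} := ([·,·]_I)_J(x,y), and the torsion T_I(x,y) := [Ix,Iy] − I[x,y]_I. Then for every R-linear endomorphism I of E and all x,y ∈ E one has 2·T_I(x,y) = [x,y]_{I,I} − [x,y]_{I∘I}. -/
variable {R : Type*} [CommRing R] {E : Type*} [AddCommGroup E] [Module R E]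

/-- Deformation of a bracket by an endomorphism: `[x,y]_I = [Ix,y] + [x,Iy] - I[x,y]`. -/
def deform (b : E → E → E) (I : E →ₗ[R] E) : E → E → E :=
  fun x y => b (I x) y + b x (I y) - I (b x y)

/-- Torsion of an endomorphism with respect to a bracket:
`T_I(x,y) = [Ix,Iy] - I [x,y]_I`. -/
def torsion (b : E → E → E) (I : E →ₗ[R] E) : E → E → E :=
  fun x y => b (I x) (I y) - I (deform b I x y)

/-- `2 T_I(x,y) = [x,y]_{I,I} - [x,y]_{I∘I}` for any bilinear bracket. -/
theorem two_smul_torsion_eq (b : E →ₗ[R] E →ₗ[R] E) (I : E →ₗ[R] E) (x y : E) :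
    2 • torsion (fun x y => b x y) I x y =
      deform (deform (fun x y => b x y) I) I x y -
        deform (fun x y => b x y) (I ∘ₗ I) x y := by
  simp only [torsion, deform, map_sub, map_add, LinearMap.comp_apply]
  abel
end

section
/- Let R be a commutative ring, E an R-module and [·,·] : E × E → E an R-bilinear map. For R-linear endomorphisms I, J of E define the Nijenhuis concomitant N(I,J)(x,y) := [Ix,Jy] − I[x,Jy] − I[Jx,y] + (I∘J)[x,y] + [Jx,Iy] − J[x,Iy] − J[Ix,y] + (J∘I)[x,y]. Then for all x,y ∈ E one has 2·N(I,J)(x,y) = [x,y]_{I,J} + [x,y]_{J,I} − [x,y]_{I∘J} − [x,y]_{J∘I}. -/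
variable {R : Type*} [CommRing R] {E : Type*} [AddCommGroup E] [Module R E]

/-- The Nijenhuis concomitant of two endomorphisms with respect to a bracket. -/
def nconc (b : E → E → E) (I J : E →ₗ[R] E) : E → E → E :=
  fun x y => b (I x) (J y) - I (b x (J y)) - I (b (J x) y) + (I ∘ₗ J) (b x y)
    + b (J x) (I y) - J (b x (I y)) - J (b (I x) y) + (J ∘ₗ I) (b x y)

/-- `2 N(I,J)(x,y) = [x,y]_{I,J} + [x,y]_{J,I} - [x,y]_{I∘J} - [x,y]_{J∘I}`. -/
theorem two_smul_nconc_eq (b : E →ₗ[R] E →ₗ[R] E) (I J : E →ₗ[R] E) (x y : E) :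
    2 • nconc (fun x y => b x y) I J x y =
      deform (deform (fun x y => b x y) I) J x y
        + deform (deform (fun x y => b x y) J) I x y
        - deform (fun x y => b x y) (I ∘ₗ J) x y
        - deform (fun x y => b x y) (J ∘ₗ I) x y := by
  simp only [nconc, deform, LinearMap.comp_apply, map_add, map_sub]
  abel
end

section
/- Let g be a finite-dimensional Lie algebra over a field K of characteristic 0, E = g × g* with the Dorfman bracket [(X,α),(Y,β)] = ([X,Y], Z ↦ α([Y,Z]) − β([X,Z])). Let N : g → g be linear with N∘N = λ·id_g for some λ ∈ K, and let J_N be the endomorphism of E given by J_N(X,α) = (NX, −α∘N). Then N is Nijenhuis on g (i.e., [NX,NY] − N[NX,Y] − N[X,NY] + N²[X,Y] = 0 for all X,Y ∈ g) if and only if the torsion of J_N with respect to the Dorfman bracket vanishes, i.e., [J_N u, J_N v] − J_N([J_N u, v] + [u, J_N v] − J_N[u,v]) = 0 for all u,v ∈ E. -/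
open Module

set_option linter.unusedSectionVars false

variable {K : Type*} [Field K] [CharZero K]
variable {g : Type*} [LieRing g] [LieAlgebra K g] [FiniteDimensional K g]

/-- The adjoint action of `x` as a linear map `z ↦ ⁅x, z⁆`. -/
def adl (x : g) : g →ₗ[K] g where
  toFun z := ⁅x, z⁆
  map_add' a b := lie_add x a b
  map_smul' c a := lie_smul c x a

@[simp] lemma adl_apply (x z : g) : adl (K := K) x z = ⁅x, z⁆ := rfl

/-- The Dorfman bracket on `g × g*`:
`[(X,α),(Y,β)] = (⁅X,Y⁆, Z ↦ α ⁅Y,Z⁆ - β ⁅X,Z⁆)`. -/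
def dorf (u v : g × Dual K g) : g × Dual K g :=
  (⁅u.1, v.1⁆, u.2 ∘ₗ adl (K := K) v.1 - v.2 ∘ₗ adl (K := K) u.1)

/-- Torsion of an endomorphism of `g × g*` with respect to the Dorfman bracket:
`T_I(u,v) = [Iu,Iv] - I([Iu,v] + [u,Iv] - I[u,v])`. -/
def torD (I : (g × Dual K g) →ₗ[K] (g × Dual K g)) (u v : g × Dual K g) :
    g × Dual K g :=
  dorf (I u) (I v) - I (dorf (I u) v + dorf u (I v) - I (dorf u v))

/-- `J_N (X, α) = (N X, -α ∘ N)`. -/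
def JN (N : g →ₗ[K] g) : (g × Dual K g) →ₗ[K] (g × Dual K g) :=
  LinearMap.prodMap N (-N.dualMap)

/-- `J_ω (X, α) = (0, ω♭ X)`. -/
def Jom (ω : g →ₗ[K] g →ₗ[K] K) : (g × Dual K g) →ₗ[K] (g × Dual K g) :=
  LinearMap.prod 0 (ω ∘ₗ LinearMap.fst K g (Dual K g))

/-- `J_π (X, α) = (π α, 0)`. -/
def Jpi (π : Dual K g →ₗ[K] g) : (g × Dual K g) →ₗ[K] (g × Dual K g) :=
  LinearMap.prod (π ∘ₗ LinearMap.snd K g (Dual K g)) 0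

/-- Deformation of a bracket on `g × g*` by an endomorphism. -/
def deformE (b : (g × Dual K g) → (g × Dual K g) → (g × Dual K g))
    (I : (g × Dual K g) →ₗ[K] (g × Dual K g)) :
    (g × Dual K g) → (g × Dual K g) → (g × Dual K g) :=
  fun u v => b (I u) v + b u (I v) - I (b u v)

/-- The Koszul bracket on `g*` associated to a bivector `θ`:
`[α,β]_θ = (Z ↦ α ⁅θβ, Z⁆ - β ⁅θα, Z⁆)`. -/
def koszul (θ : Dual K g →ₗ[K] g) (α β : Dual K g) : Dual K g :=
  α ∘ₗ adl (K := K) (θ β) - β ∘ₗ adl (K := K) (θ α)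

lemma torD_JN_fst (N : g →ₗ[K] g) (u v : g × Dual K g) :
    (torD (JN N) u v).1 =
      ⁅N u.1, N v.1⁆ - N ⁅N u.1, v.1⁆ - N ⁅u.1, N v.1⁆ + (N ∘ₗ N) ⁅u.1, v.1⁆ := by
  simp only [torD, dorf, JN, LinearMap.prodMap_apply, Prod.fst_sub, Prod.fst_add, map_sub,
    map_add, LinearMap.comp_apply]
  abel

lemma torD_JN_snd_apply (N : g →ₗ[K] g) (lam : K)
    (hN2 : N ∘ₗ N = lam • (LinearMap.id : g →ₗ[K] g)) (u v : g × Dual K g) (Z : g) :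
    (torD (JN N) u v).2 Z =
      u.2 (⁅N v.1, N Z⁆ - N ⁅N v.1, Z⁆ - N ⁅v.1, N Z⁆ + (N ∘ₗ N) ⁅v.1, Z⁆) -
        v.2 (⁅N u.1, N Z⁆ - N ⁅N u.1, Z⁆ - N ⁅u.1, N Z⁆ + (N ∘ₗ N) ⁅u.1, Z⁆) := by
  have h (x : g) : N (N x) = lam • x := LinearMap.congr_fun hN2 x
  simp only [torD, dorf, JN, LinearMap.prodMap_apply, Prod.snd_sub, Prod.snd_add, map_sub,
    map_add, LinearMap.comp_apply, LinearMap.sub_apply, LinearMap.add_apply,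
    LinearMap.neg_apply, LinearMap.dualMap_apply, adl_apply, h, map_smul]
  ring

/-- For `N` with `N² = λ id`, `N` is Nijenhuis on `g` iff the torsion of `J_N`
with respect to the Dorfman bracket on `g × g*` vanishes. -/
theorem nijenhuis_iff_torD_JN (N : g →ₗ[K] g) (lam : K)
    (hN2 : N ∘ₗ N = lam • (LinearMap.id : g →ₗ[K] g)) :
    (∀ X Y : g, ⁅N X, N Y⁆ - N ⁅N X, Y⁆ - N ⁅X, N Y⁆ + (N ∘ₗ N) ⁅X, Y⁆ = 0) ↔
      ∀ u v : g × Dual K g, torD (JN N) u v = 0 := by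
  constructor
  · intro h u v
    refine Prod.ext ?_ (LinearMap.ext fun Z => ?_)
    · rw [torD_JN_fst, h, Prod.fst_zero]
    · rw [torD_JN_snd_apply N lam hN2, h, h, map_zero, map_zero, sub_zero, Prod.snd_zero,
        LinearMap.zero_apply]
  · intro h X Y
    simpa only [torD_JN_fst, Prod.fst_zero] using congrArg Prod.fst (h (X, 0) (Y, 0))
end

section
/- Let g be a finite-dimensional Lie algebra over a field K of characteristic 0, E = g × g* with the Dorfman bracket [(X,α),(Y,β)] = ([X,Y], Z ↦ α([Y,Z]) − β([X,Z])). Let ω be a 2-form on g and I_ω the endomorphism of E given by I_ω(X,α) = (X, ω♭X − α), where ω♭X = ω(X,·). Then ω is closed (i.e., ω([X,Y],Z) + ω([Y,Z],X) + ω([Z,X],Y) = 0 for all X,Y,Z ∈ g) if and only if the torsion of I_ω with respect to the Dorfman bracket vanishes. -/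
open Module

set_option linter.unusedSectionVars false

variable {K : Type*} [Field K] [CharZero K]
variable {g : Type*} [LieRing g] [LieAlgebra K g] [FiniteDimensional K g]

/-- `I_ω (X, α) = (X, ω♭ X - α)`. -/
def Iom (ω : g →ₗ[K] g →ₗ[K] K) : (g × Dual K g) →ₗ[K] (g × Dual K g) :=
  LinearMap.prod (LinearMap.fst K g (Dual K g))
    (ω ∘ₗ LinearMap.fst K g (Dual K g) - LinearMap.snd K g (Dual K g))

/-- The torsion of `Iom ω` is `-2` times the exterior derivative of `ω`. -/
lemma torD_Iom_apply (ω : g →ₗ[K] g →ₗ[K] K) (hAlt : ∀ X, ω X X = 0)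
    (u v : g × Dual K g) (Z : g) :
    (torD (Iom ω) u v).2 Z =
      -2 * (ω ⁅u.1, v.1⁆ Z + ω ⁅v.1, Z⁆ u.1 + ω ⁅Z, u.1⁆ v.1) := by
  have h_skew : ∀ X Y, -ω X Y = ω Y X := LinearMap.IsAlt.neg hAlt
  have h₁ := h_skew ⁅v.1, Z⁆ u.1
  have h₂ := h_skew ⁅Z, u.1⁆ v.1
  have h₃ : ω v.1 ⁅Z, u.1⁆ = -ω v.1 ⁅u.1, Z⁆ := by rw [← lie_skew, map_neg]
  simp [torD, dorf, Iom]
  linear_combination -2 * h₁ - 2 * h₂ - 2 * h₃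

lemma torD_Iom_fst (ω : g →ₗ[K] g →ₗ[K] K) (u v : g × Dual K g) :
    (torD (Iom ω) u v).1 = 0 := by
  simp [torD, dorf, Iom]

/-- A 2-form `ω` on `g` is closed iff the torsion of `I_ω` with respect to the
Dorfman bracket on `g × g*` vanishes. -/
theorem closed_iff_torD_Iom (ω : g →ₗ[K] g →ₗ[K] K) (hAlt : ∀ X, ω X X = 0) :
    (∀ X Y Z : g, ω ⁅X, Y⁆ Z + ω ⁅Y, Z⁆ X + ω ⁅Z, X⁆ Y = 0) ↔
      ∀ u v : g × Dual K g, torD (Iom ω) u v = 0 := by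
  constructor
  · intro h u v
    ext Z
    · exact torD_Iom_fst ω u v
    · simp [torD_Iom_apply ω hAlt, h]
  · intro h X Y Z
    have hZ := torD_Iom_apply ω hAlt (X, 0) (Y, 0) Z
    simpa [h] using hZ
end

section
/- Let g be a finite-dimensional Lie algebra over a field K of characteristic 0, E = g × g* with the Dorfman bracket [(X,α),(Y,β)] = ([X,Y], Z ↦ α([Y,Z]) − β([X,Z])). Let π : g* → g be a bivector (α(πβ) = −β(πα) for all α,β ∈ g*) and J_π the endomorphism of E given by J_π(X,α) = (πα, 0). Then π is Poisson (i.e., α([πβ,πγ]) + β([πγ,πα]) + γ([πα,πβ]) = 0 for all α,β,γ ∈ g*) if and only if the torsion of J_π with respect to the Dorfman bracket vanishes. -/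
open Module

set_option linter.unusedSectionVars false

variable {K : Type*} [Field K] [CharZero K]
variable {g : Type*} [LieRing g] [LieAlgebra K g] [FiniteDimensional K g]

lemma torD_Jpi (π : Dual K g →ₗ[K] g) (u v : g × Dual K g) :
    torD (Jpi π) u v = (⁅π u.2, π v.2⁆ - π (koszul π u.2 v.2), 0) := by
  ext <;> simp [torD, dorf, Jpi, koszul, sub_eq_add_neg, add_comm]

lemma apply_lie_sub_koszul (π : Dual K g →ₗ[K] g)
    (hskew : ∀ α β : Dual K g, α (π β) = -β (π α)) (α β γ : Dual K g) :
    γ (⁅π α, π β⁆ - π (koszul π α β)) =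
      α ⁅π β, π γ⁆ + β ⁅π γ, π α⁆ + γ ⁅π α, π β⁆ := by
  rw [map_sub, hskew γ, ← lie_skew (π γ) (π α), map_neg]
  simp only [koszul, LinearMap.sub_apply, LinearMap.comp_apply, adl_apply]
  ring

/-- A bivector `π` on `g` is Poisson iff the torsion of `J_π` with respect to
the Dorfman bracket on `g × g*` vanishes. -/
theorem poisson_iff_torD_Jpi (π : Dual K g →ₗ[K] g)
    (hskew : ∀ α β : Dual K g, α (π β) = -β (π α)) :
    (∀ α β γ : Dual K g, α ⁅π β, π γ⁆ + β ⁅π γ, π α⁆ + γ ⁅π α, π β⁆ = 0) ↔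
      ∀ u v : g × Dual K g, torD (Jpi π) u v = 0 := by
  constructor
  · intro h u v
    rw [torD_Jpi, Prod.mk_eq_zero]
    refine ⟨(forall_dual_apply_eq_zero_iff K _).mp fun γ => ?_, rfl⟩
    rw [apply_lie_sub_koszul π hskew, h]
  · intro h α β γ
    have hT := h (0, α) (0, β)
    rw [torD_Jpi, Prod.mk_eq_zero] at hT
    rw [← apply_lie_sub_koszul π hskew, hT.1, map_zero]
end

section
/- Let g be a finite-dimensional Lie algebra over a field K of characteristic 0, E = g × g* with the symmetric pairing ⟨(X,α),(Y,β)⟩ = α(Y) + β(X) and the Dorfman bracket [(X,α),(Y,β)] = ([X,Y], Z ↦ α([Y,Z]) − β([X,Z])). Let ω be a closed 2-form on g and N : g → g a Nijenhuis endomorphism. Then (ω,N) is an ΩN structure on g (i.e., additionally ω(NX,Y) = ω(X,NY) for all X,Y and the 2-form ω_N, ω_N(X,Y) = ω(NX,Y), is closed) if and only if (J_ω, J_N) is a compatible pair on E, i.e., J_ω∘J_N = −J_N∘J_ω and [u,v]_{J_ω,J_N} + [u,v]_{J_N,J_ω} = 0 for all u,v ∈ E. -/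
open Module

set_option linter.unusedSectionVars false

variable {K : Type*} [Field K] [CharZero K]
variable {g : Type*} [LieRing g] [LieAlgebra K g] [FiniteDimensional K g]

/-- Deforming the Dorfman bracket by `J_ω` gives zero when `ω` is a closed 2-form. -/
lemma deformE_dorf_Jom_eq_zero (ω : g →ₗ[K] g →ₗ[K] K) (hskew : ∀ X Y, ω X Y = -ω Y X)
    (hcl : ∀ X Y Z : g, ω ⁅X, Y⁆ Z + ω ⁅Y, Z⁆ X + ω ⁅Z, X⁆ Y = 0) (u v : g × Dual K g) :
    deformE dorf (Jom ω) u v = 0 := by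
  refine Prod.ext (by simp [deformE, dorf, Jom]) (LinearMap.ext fun Z => ?_)
  have h := hcl u.1 v.1 Z
  rw [← lie_skew Z u.1, map_neg, LinearMap.neg_apply] at h
  simp [deformE, dorf, Jom, hskew u.1 ⁅v.1, Z⁆, hskew v.1 ⁅u.1, Z⁆]
  linear_combination -h

/-- The endomorphisms `J_ω` and `J_N` anticommute iff `ω(NX, Y) = ω(X, NY)`. -/
lemma Jom_comp_JN_eq_neg_iff (ω : g →ₗ[K] g →ₗ[K] K) (N : g →ₗ[K] g) :
    Jom ω ∘ₗ JN N = -(JN N ∘ₗ Jom ω) ↔ ∀ X Y : g, ω (N X) Y = ω X (N Y) := by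
  constructor
  · intro h X Y
    simpa [Jom, JN] using congrArg (fun p : g × Dual K g => p.2 Y) (LinearMap.congr_fun h (X, 0))
  · intro h
    refine LinearMap.ext fun u => Prod.ext (by simp [Jom, JN]) (LinearMap.ext fun Z => ?_)
    simpa [Jom, JN] using h u.1 Z

/-- The deformation of the Dorfman bracket by `J_N` and then `J_ω` is twice the differential
of `ω_N`. -/
lemma deformE_deformE_dorf_JN_Jom (ω : g →ₗ[K] g →ₗ[K] K) (hskew : ∀ X Y, ω X Y = -ω Y X)
    (hcl : ∀ X Y Z : g, ω ⁅X, Y⁆ Z + ω ⁅Y, Z⁆ X + ω ⁅Z, X⁆ Y = 0) (N : g →ₗ[K] g)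
    (hN : ∀ X Y : g, ω (N X) Y = ω X (N Y)) (u v : g × Dual K g) (Z : g) :
    (deformE (deformE dorf (JN N)) (Jom ω) u v).2 Z =
      2 * (ω (N ⁅u.1, v.1⁆) Z + ω (N ⁅v.1, Z⁆) u.1 + ω (N ⁅Z, u.1⁆) v.1) := by
  obtain ⟨X, α⟩ := u
  obtain ⟨Y, β⟩ := v
  have h₁ := hcl (N X) Y Z
  have h₂ := hcl X (N Y) Z
  have h₃ := hcl X Y (N Z)
  rw [← lie_skew Z (N X), map_neg, LinearMap.neg_apply, ← hN] at h₁
  rw [← lie_skew Z X, map_neg, LinearMap.neg_apply, ← hN] at h₂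
  rw [← lie_skew (N Z) X, map_neg, LinearMap.neg_apply, ← hN] at h₃
  simp [deformE, dorf, Jom, JN, hskew X ⁅_, _⁆, hskew Y ⁅_, _⁆, hskew X (N _), hskew Y (N _)]
  rw [← lie_skew Z X, map_neg, map_neg, LinearMap.neg_apply]
  linear_combination -h₁ - h₂ - h₃

/-- For a closed 2-form `ω` and a Nijenhuis tensor `N` on `g`, the pair `(ω, N)`
is an ΩN structure iff `(J_ω, J_N)` is a compatible pair on `g × g*`. -/
theorem omegaN_iff_compatible_pair (ω : g →ₗ[K] g →ₗ[K] K) (hAlt : ∀ X, ω X X = 0)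
    (hcl : ∀ X Y Z : g, ω ⁅X, Y⁆ Z + ω ⁅Y, Z⁆ X + ω ⁅Z, X⁆ Y = 0)
    (N : g →ₗ[K] g)
    (hNij : ∀ X Y : g, ⁅N X, N Y⁆ - N ⁅N X, Y⁆ - N ⁅X, N Y⁆ + N (N ⁅X, Y⁆) = 0) :
    ((∀ X Y : g, ω (N X) Y = ω X (N Y)) ∧
      (∀ X Y Z : g, ω (N ⁅X, Y⁆) Z + ω (N ⁅Y, Z⁆) X + ω (N ⁅Z, X⁆) Y = 0)) ↔
      (Jom ω ∘ₗ JN N = -(JN N ∘ₗ Jom ω) ∧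
        ∀ u v : g × Dual K g,
          deformE (deformE dorf (Jom ω)) (JN N) u v
            + deformE (deformE dorf (JN N)) (Jom ω) u v = 0) := by
  have hskew : ∀ X Y, ω X Y = -ω Y X := fun X Y =>
    (LinearMap.IsAlt.neg (B := ω) hAlt Y X).symm
  have hsum : ∀ u v : g × Dual K g,
      deformE (deformE dorf (Jom ω)) (JN N) u v = 0 := fun u v => by
    rw [deformE]
    simp [deformE_dorf_Jom_eq_zero ω hskew hcl]
  rw [Jom_comp_JN_eq_neg_iff]
  refine and_congr_right fun hN => ?_
  simp only [hsum, zero_add]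
  constructor
  · intro h u v
    refine Prod.ext (by simp [deformE, dorf, Jom, JN]) (LinearMap.ext fun Z => ?_)
    rw [deformE_deformE_dorf_JN_Jom ω hskew hcl N hN, h]
    simp
  · intro h X Y Z
    have := deformE_deformE_dorf_JN_Jom ω hskew hcl N hN (X, 0) (Y, 0) Z
    rw [h] at this
    simpa using this.symm
end

section
/- Let g be a finite-dimensional Lie algebra over a field K of characteristic 0, E = g × g* with the Dorfman bracket [(X,α),(Y,β)] = ([X,Y], Z ↦ α([Y,Z]) − β([X,Z])). Let ω be a closed 2-form on g and N : g → g linear with N∘N = λ·id_g for some λ ∈ K. Then (ω,N) is an ΩN structure on g if and only if the endomorphism J_ω + J_N of E has vanishing torsion with respect to the Dorfman bracket and J_ω∘J_N + J_N∘J_ω = 0. -/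
open Module

set_option linter.unusedSectionVars false

variable {K : Type*} [Field K] [CharZero K]
variable {g : Type*} [LieRing g] [LieAlgebra K g] [FiniteDimensional K g]

lemma torD_fst (ω : g →ₗ[K] g →ₗ[K] K) (N : g →ₗ[K] g) (u v : g × Dual K g) :
    (torD (Jom ω + JN N) u v).1 =
      ⁅N u.1, N v.1⁆ - N ⁅N u.1, v.1⁆ - N ⁅u.1, N v.1⁆ + N (N ⁅u.1, v.1⁆) := by
  simp [torD, dorf, Jom, JN]
  abel

lemma torD_snd_apply (ω : g →ₗ[K] g →ₗ[K] K) (hAlt : ∀ X, ω X X = 0)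
    (hcl : ∀ X Y Z : g, ω ⁅X, Y⁆ Z + ω ⁅Y, Z⁆ X + ω ⁅Z, X⁆ Y = 0)
    (N : g →ₗ[K] g) (lam : K) (hN : ∀ X, N (N X) = lam • X)
    (hsym : ∀ X Y : g, ω (N X) Y = ω X (N Y)) (u v : g × Dual K g) (Z : g) :
    (torD (Jom ω + JN N) u v).2 Z =
      (ω (N ⁅u.1, v.1⁆) Z + ω (N ⁅v.1, Z⁆) u.1 + ω (N ⁅Z, u.1⁆) v.1)
      + u.2 (⁅N v.1, N Z⁆ - N ⁅N v.1, Z⁆ - N ⁅v.1, N Z⁆ + N (N ⁅v.1, Z⁆))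
      - v.2 (⁅N u.1, N Z⁆ - N ⁅N u.1, Z⁆ - N ⁅u.1, N Z⁆ + N (N ⁅u.1, Z⁆)) := by
  have hskew : ∀ X Y, ω X Y = -ω Y X := fun X Y => (LinearMap.IsAlt.neg hAlt Y X).symm
  have hcl' : ∀ X Y Z : g, ω X ⁅Y, Z⁆ = ω ⁅X, Y⁆ Z + ω Y ⁅X, Z⁆ := fun X Y Z => by
    have h := hcl X Y Z
    rw [hskew ⁅Y, Z⁆ X, hskew ⁅Z, X⁆ Y, ← lie_skew Z X, map_neg] at h
    linear_combination -h
  obtain ⟨X, α⟩ := u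
  obtain ⟨Y, β⟩ := v
  have h1 := hcl' X (N Y) Z
  have h2 := hcl' Y (N X) Z
  have h3 := hcl' X Y (N Z)
  have h4 : ω (N ⁅Y, Z⁆) X = -ω (N X) ⁅Y, Z⁆ := by rw [hskew, hsym]
  have h5 : ω (N ⁅Z, X⁆) Y = ω (N Y) ⁅X, Z⁆ := by
    rw [hskew, hsym, ← lie_skew X Z, map_neg, map_neg]
  have h6 : ω ⁅Y, N X⁆ Z = -ω ⁅N X, Y⁆ Z := by
    rw [← lie_skew, map_neg, LinearMap.neg_apply]
  simp [torD, dorf, Jom, JN, hN]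
  linear_combination h1 - h2 + h3 - h4 - h5 - h6

lemma Jom_JN_anticommute_iff (ω : g →ₗ[K] g →ₗ[K] K) (N : g →ₗ[K] g) :
    Jom ω ∘ₗ JN N + JN N ∘ₗ Jom ω = 0 ↔ ∀ X Y : g, ω (N X) Y = ω X (N Y) := by
  constructor
  · intro h X Y
    have h' := LinearMap.congr_fun (congrArg Prod.snd (LinearMap.congr_fun h (X, 0))) Y
    simp [Jom, JN] at h'
    linear_combination h'
  · intro h
    refine LinearMap.ext fun u => Prod.ext ?_ (LinearMap.ext fun Y => ?_)
    · simp [Jom, JN]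
    · simp [Jom, JN, h]

/-- For a closed 2-form `ω` and `N` with `N² = λ id`, the pair `(ω, N)` is an
ΩN structure on `g` iff `J_ω + J_N` has vanishing torsion on `g × g*` and
`J_ω` and `J_N` anti-commute. -/
theorem omegaN_iff_torD (ω : g →ₗ[K] g →ₗ[K] K) (hAlt : ∀ X, ω X X = 0)
    (hcl : ∀ X Y Z : g, ω ⁅X, Y⁆ Z + ω ⁅Y, Z⁆ X + ω ⁅Z, X⁆ Y = 0)
    (N : g →ₗ[K] g) (lam : K)
    (hN2 : N ∘ₗ N = lam • (LinearMap.id : g →ₗ[K] g)) :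
    ((∀ X Y : g, ⁅N X, N Y⁆ - N ⁅N X, Y⁆ - N ⁅X, N Y⁆ + N (N ⁅X, Y⁆) = 0) ∧
      (∀ X Y : g, ω (N X) Y = ω X (N Y)) ∧
      (∀ X Y Z : g, ω (N ⁅X, Y⁆) Z + ω (N ⁅Y, Z⁆) X + ω (N ⁅Z, X⁆) Y = 0)) ↔
      ((∀ u v : g × Dual K g, torD (Jom ω + JN N) u v = 0) ∧
        Jom ω ∘ₗ JN N + JN N ∘ₗ Jom ω = 0) := by
  have hN : ∀ X, N (N X) = lam • X := fun X => LinearMap.congr_fun hN2 X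
  rw [Jom_JN_anticommute_iff]
  constructor
  · rintro ⟨hnij, hsym, hclN⟩
    refine ⟨fun u v => Prod.ext ?_ (LinearMap.ext fun Z => ?_), hsym⟩
    · rw [torD_fst, hnij, Prod.fst_zero]
    · rw [torD_snd_apply ω hAlt hcl N lam hN hsym, hclN, hnij, hnij]
      simp
  · rintro ⟨htor, hsym⟩
    refine ⟨fun X Y => ?_, hsym, fun X Y Z => ?_⟩
    · rw [← torD_fst ω N (X, 0) (Y, 0), htor, Prod.fst_zero]
    · have h := torD_snd_apply ω hAlt hcl N lam hN hsym (X, 0) (Y, 0) Z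
      rw [htor] at h
      simpa using h.symm
end

section
/- Let g be a finite-dimensional Lie algebra over a field K of characteristic 0, E = g × g* with the symmetric pairing ⟨(X,α),(Y,β)⟩ = α(Y) + β(X) and the Dorfman bracket [(X,α),(Y,β)] = ([X,Y], Z ↦ α([Y,Z]) − β([X,Z])). Let π be a Poisson bivector on g and N : g → g a Nijenhuis endomorphism. Then (π,N) is a Poisson–Nijenhuis structure on g (i.e., additionally N(πα) = π(α∘N) for all α ∈ g* and [α,β]_{N∘π} = [α∘N,β]_π + [α,β∘N]_π − ([α,β]_π)∘N for all α,β ∈ g*) if and only if (J_π, J_N) is a compatible pair on E, i.e., J_π∘J_N = −J_N∘J_π and [u,v]_{J_π,J_N} + [u,v]_{J_N,J_π} = 0 for all u,v ∈ E. -/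
open Module

set_option linter.unusedSectionVars false

variable {K : Type*} [Field K] [CharZero K]
variable {g : Type*} [LieRing g] [LieAlgebra K g] [FiniteDimensional K g]

lemma dorf_add_left (u u' v : g × Dual K g) : dorf (u + u') v = dorf u v + dorf u' v := by
  ext <;> simp [dorf]
  abel

lemma dorf_add_right (u v v' : g × Dual K g) : dorf u (v + v') = dorf u v + dorf u v' := by
  ext <;> simp [dorf]
  abel

lemma dorf_zero_left (v : g × Dual K g) : dorf 0 v = 0 := by
  ext <;> simp [dorf]

lemma dorf_zero_right (u : g × Dual K g) : dorf u 0 = 0 := by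
  ext <;> simp [dorf]

/-- The concomitant of two endomorphisms of `g × g*` with respect to the Dorfman bracket. -/
def concomitant (I J : (g × Dual K g) →ₗ[K] (g × Dual K g)) (u v : g × Dual K g) :
    g × Dual K g :=
  dorf (J u) (I v) + dorf (I u) (J v) - I (dorf (J u) v + dorf u (J v))
    - J (dorf (I u) v + dorf u (I v))

lemma deformE_add_deformE_of_anticommute {I J : (g × Dual K g) →ₗ[K] (g × Dual K g)}
    (h : I ∘ₗ J = -(J ∘ₗ I)) (u v : g × Dual K g) :
    deformE (deformE dorf I) J u v + deformE (deformE dorf J) I u v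
      = (2 : K) • concomitant I J u v := by
  have h0 (w : g × Dual K g) : I (J w) + J (I w) = 0 := by
    rw [← LinearMap.comp_apply, h]
    simp
  have hl : dorf (I (J u)) v + dorf (J (I u)) v = 0 := by
    rw [← dorf_add_left, h0, dorf_zero_left]
  have hr : dorf u (I (J v)) + dorf u (J (I v)) = 0 := by
    rw [← dorf_add_right, h0, dorf_zero_right]
  simp only [deformE, concomitant, map_add, map_sub, two_smul]
  linear_combination (norm := abel) hl + hr + h0 (dorf u v)

lemma Jpi_anticommute_JN_iff (π : Dual K g →ₗ[K] g) (N : g →ₗ[K] g) :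
    Jpi π ∘ₗ JN N = -(JN N ∘ₗ Jpi π) ↔ ∀ α : Dual K g, N (π α) = π (N.dualMap α) := by
  constructor
  · intro h α
    have := congrArg Prod.fst (LinearMap.congr_fun h (0, α))
    simpa [Jpi, JN] using this.symm
  · intro h
    refine LinearMap.ext fun u => ?_
    ext <;> simp [Jpi, JN, h]

lemma koszul_comp_eq_iff {π : Dual K g →ₗ[K] g} {N : g →ₗ[K] g}
    (hN : ∀ α : Dual K g, N (π α) = π (N.dualMap α)) (α β : Dual K g) :
    koszul (N ∘ₗ π) α β = koszul π (N.dualMap α) β + koszul π α (N.dualMap β)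
        - N.dualMap (koszul π α β) ↔
      ∀ Z : g, α (N ⁅π β, Z⁆) - β (N ⁅π α, Z⁆) = α ⁅π β, N Z⁆ - β ⁅π α, N Z⁆ := by
  rw [LinearMap.ext_iff]
  refine forall_congr' fun Z => ?_
  simp only [koszul, LinearMap.sub_apply, LinearMap.add_apply, LinearMap.comp_apply, adl_apply,
    LinearMap.dualMap_apply, ← hN]
  constructor <;> intro h <;> linear_combination -h

lemma concomitant_Jpi_JN_snd_apply (π : Dual K g →ₗ[K] g) (N : g →ₗ[K] g)
    (u v : g × Dual K g) (Z : g) :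
    (concomitant (Jpi π) (JN N) u v).2 Z =
      u.2 ⁅π v.2, N Z⁆ - v.2 ⁅π u.2, N Z⁆ - (u.2 (N ⁅π v.2, Z⁆) - v.2 (N ⁅π u.2, Z⁆)) := by
  simp [concomitant, dorf, Jpi, JN]
  ring

lemma apply_concomitant_Jpi_JN_fst {π : Dual K g →ₗ[K] g}
    (hskew : ∀ α β : Dual K g, α (π β) = -β (π α)) (N : g →ₗ[K] g)
    (u v : g × Dual K g) (γ : Dual K g) :
    γ (concomitant (Jpi π) (JN N) u v).1 =
      γ (N ⁅π v.2, u.1⁆) - v.2 (N ⁅π γ, u.1⁆) - (γ ⁅π v.2, N u.1⁆ - v.2 ⁅π γ, N u.1⁆)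
        - (γ (N ⁅π u.2, v.1⁆) - u.2 (N ⁅π γ, v.1⁆)
          - (γ ⁅π u.2, N v.1⁆ - u.2 ⁅π γ, N v.1⁆)) := by
  rw [← lie_skew (π v.2) u.1, ← lie_skew (π γ) u.1, ← lie_skew (π v.2) (N u.1),
    ← lie_skew (π γ) (N u.1), ← lie_skew (π γ) v.1, ← lie_skew (π γ) (N v.1)]
  simp [concomitant, dorf, Jpi, JN, -lie_skew, hskew γ]
  ring

/-- For a Poisson bivector `π` and a Nijenhuis tensor `N` on `g`, the pair
`(π, N)` is a Poisson–Nijenhuis structure iff `(J_π, J_N)` is a compatible pair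
on `g × g*`. -/
theorem pn_iff_compatible_pair (π : Dual K g →ₗ[K] g)
    (hskew : ∀ α β : Dual K g, α (π β) = -β (π α))
    (hPoisson : ∀ α β γ : Dual K g, α ⁅π β, π γ⁆ + β ⁅π γ, π α⁆ + γ ⁅π α, π β⁆ = 0)
    (N : g →ₗ[K] g)
    (hNij : ∀ X Y : g, ⁅N X, N Y⁆ - N ⁅N X, Y⁆ - N ⁅X, N Y⁆ + N (N ⁅X, Y⁆) = 0) :
    ((∀ α : Dual K g, N (π α) = π (N.dualMap α)) ∧
      (∀ α β : Dual K g,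
        koszul (N ∘ₗ π) α β =
          koszul π (N.dualMap α) β + koszul π α (N.dualMap β)
            - N.dualMap (koszul π α β))) ↔
      (Jpi π ∘ₗ JN N = -(JN N ∘ₗ Jpi π) ∧
        ∀ u v : g × Dual K g,
          deformE (deformE dorf (Jpi π)) (JN N) u v
            + deformE (deformE dorf (JN N)) (Jpi π) u v = 0) := by
  rw [← Jpi_anticommute_JN_iff]
  refine and_congr_right fun hanti => ?_
  have hN := (Jpi_anticommute_JN_iff π N).1 hanti
  simp only [koszul_comp_eq_iff hN, deformE_add_deformE_of_anticommute hanti,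
    smul_eq_zero_iff_right (two_ne_zero' K)]
  constructor
  · intro h u v
    refine Prod.ext ((Module.forall_dual_apply_eq_zero_iff K _).1 fun γ => ?_)
      (LinearMap.ext fun Z => ?_)
    · rw [apply_concomitant_Jpi_JN_fst hskew, h, h]
      simp
    · rw [concomitant_Jpi_JN_snd_apply, h]
      simp
  · intro h α β Z
    have := concomitant_Jpi_JN_snd_apply π N (0, α) (0, β) Z
    rw [h] at this
    exact (sub_eq_zero.1 this.symm).symm
end

section
/- Let g be a finite-dimensional Lie algebra over a field K of characteristic 0, E = g × g* with the Dorfman bracket [(X,α),(Y,β)] = ([X,Y], Z ↦ α([Y,Z]) − β([X,Z])). Let π be a bivector, ω a 2-form and N : g → g linear, such that N(πα) = π(α∘N) for all α ∈ g*, ω(NX,Y) = ω(X,NY) for all X,Y ∈ g, and N∘N = λ·id_g for some λ ∈ K. If the endomorphism J_N + J_π + J_ω of E has vanishing torsion with respect to the Dorfman bracket, then: (i) π is Poisson; (ii) [α,β]_{N∘π} = [α∘N,β]_π + [α,β∘N]_π − ([α,β]_π)∘N for all α,β ∈ g*; (iii) the Nijenhuis torsion of N satisfies [NX,NY] − N[NX,Y]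 − N[X,NY] + N²[X,Y] = π(dω(X,Y,·)) for all X,Y ∈ g, where dω(X,Y,Z) = −ω([X,Y],Z) + ω([X,Z],Y) − ω([Y,Z],X); and (iv) dω(NX,Y,Z) + dω(X,NY,Z) + dω(X,Y,NZ) = d(ω_N)(X,Y,Z) for all X,Y,Z ∈ g, where ω_N(X,Y) = ω(NX,Y) and d(ω_N) is given by the same formula as dω (i.e., (π, N, dω) is an exact Poisson quasi-Nijenhuis structure on g). -/
open Module

set_option linter.unusedSectionVars false

variable {K : Type*} [Field K] [CharZero K]
variable {g : Type*} [LieRing g] [LieAlgebra K g] [FiniteDimensional K g]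

/-- The Chevalley–Eilenberg differential of a 2-form, as a map `g → g → g*`:
`dω(X,Y,Z) = -ω(⁅X,Y⁆,Z) + ω(⁅X,Z⁆,Y) - ω(⁅Y,Z⁆,X)`. -/
def dOm (ω : g →ₗ[K] g →ₗ[K] K) (X Y : g) : Dual K g :=
  -(ω ⁅X, Y⁆) + ω.flip Y ∘ₗ adl (K := K) X - ω.flip X ∘ₗ adl (K := K) Y

lemma JN_add_Jpi_add_Jom_apply (π : Dual K g →ₗ[K] g) (ω : g →ₗ[K] g →ₗ[K] K)
    (N : g →ₗ[K] g) (u : g × Dual K g) :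
    (JN N + Jpi π + Jom ω) u = (N u.1 + π u.2, -N.dualMap u.2 + ω u.1) := by
  ext <;> simp [JN, Jpi, Jom]

/-- The torsion of `J_N + J_π + J_ω` on a pair of covectors. -/
lemma torD_inr_inr (π : Dual K g →ₗ[K] g) (ω : g →ₗ[K] g →ₗ[K] K)
    (N : g →ₗ[K] g) (α β : Dual K g) :
    torD (JN N + Jpi π + Jom ω) (0, α) (0, β) =
      (⁅π α, π β⁆ - π (koszul π α β),
        N.dualMap (koszul π α β) - (N.dualMap α ∘ₗ adl (K := K) (π β)
          - N.dualMap β ∘ₗ adl (K := K) (π α))) := by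
  have h0 : dorf ((0 : g), α) (0, β) = 0 := by
    ext <;> simp [dorf]
  have h1 : dorf (π α, -N.dualMap α) (0, β) + dorf (0, α) (π β, -N.dualMap β)
      = (0, koszul π α β) := by
    ext
    · simp [dorf]
    · simp [dorf, koszul]
      ring
  simp only [torD, h0, JN_add_Jpi_add_Jom_apply, map_zero, zero_add, add_zero, sub_zero, h1]
  ext
  · simp [dorf]
  · simp [dorf]
    ring

/-- The torsion of `J_N + J_π + J_ω` on a pair of vectors. -/
lemma torD_inl_inl (π : Dual K g →ₗ[K] g) (ω : g →ₗ[K] g →ₗ[K] K) (hAlt : ω.IsAlt)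
    (N : g →ₗ[K] g) (X Y : g) :
    torD (JN N + Jpi π + Jom ω) (X, 0) (Y, 0) =
      (⁅N X, N Y⁆ - (N (⁅N X, Y⁆ + ⁅X, N Y⁆ - N ⁅X, Y⁆) + π (dOm ω X Y)),
        ω X ∘ₗ adl (K := K) (N Y) - ω Y ∘ₗ adl (K := K) (N X)
          - (-N.dualMap (dOm ω X Y) + ω (⁅N X, Y⁆ + ⁅X, N Y⁆ - N ⁅X, Y⁆))) := by
  have h0 : dorf (X, (0 : Dual K g)) (Y, 0) = (⁅X, Y⁆, 0) := by
    ext <;> simp [dorf]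
  have h1 : dorf (N X, ω X) (Y, 0) + dorf (X, 0) (N Y, ω Y) - (N ⁅X, Y⁆, ω ⁅X, Y⁆)
      = (⁅N X, Y⁆ + ⁅X, N Y⁆ - N ⁅X, Y⁆, dOm ω X Y) := by
    ext Z
    · simp [dorf]
    · simp [dorf, dOm, ← hAlt.neg ⁅X, Z⁆ Y, ← hAlt.neg ⁅Y, Z⁆ X]
      ring
  simp only [torD, h0, JN_add_Jpi_add_Jom_apply, map_zero, zero_add, add_zero, neg_zero, h1]
  rfl

/-- If `J_N + J_π + J_ω` has vanishing torsion on `g × g*`, then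
`(π, N, dω)` is an exact Poisson quasi-Nijenhuis structure on `g`. -/
theorem exact_pqn_of_torD (π : Dual K g →ₗ[K] g)
    (hskew : ∀ α β : Dual K g, α (π β) = -β (π α))
    (ω : g →ₗ[K] g →ₗ[K] K) (hAlt : ∀ X, ω X X = 0)
    (N : g →ₗ[K] g)
    (hcompat₁ : ∀ α : Dual K g, N (π α) = π (N.dualMap α))
    (hcompat₂ : ∀ X Y : g, ω (N X) Y = ω X (N Y))
    (lam : K) (hN2 : N ∘ₗ N = lam • (LinearMap.id : g →ₗ[K] g))
    (htor : ∀ u v : g × Dual K g, torD (JN N + Jpi π + Jom ω) u v = 0) :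
    (∀ α β γ : Dual K g, α ⁅π β, π γ⁆ + β ⁅π γ, π α⁆ + γ ⁅π α, π β⁆ = 0) ∧
    (∀ α β : Dual K g,
      koszul (N ∘ₗ π) α β =
        koszul π (N.dualMap α) β + koszul π α (N.dualMap β)
          - N.dualMap (koszul π α β)) ∧
    (∀ X Y : g,
      ⁅N X, N Y⁆ - N ⁅N X, Y⁆ - N ⁅X, N Y⁆ + N (N ⁅X, Y⁆) = π (dOm ω X Y)) ∧
    (∀ X Y Z : g,
      dOm ω (N X) Y Z + dOm ω X (N Y) Z + dOm ω X Y (N Z)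
        = dOm (ω ∘ₗ N) X Y Z) := by
  have hA : ω.IsAlt := hAlt
  have hinr (α β : Dual K g) := (torD_inr_inr π ω N α β).symm.trans (htor _ _)
  have hinl (X Y : g) := (torD_inl_inl π ω hA N X Y).symm.trans (htor _ _)
  simp only [Prod.mk_eq_zero] at hinr hinl
  refine ⟨fun α β γ => ?_, fun α β => ?_, fun X Y => ?_, fun X Y Z => ?_⟩
  · rw [sub_eq_zero.mp (hinr α β).1, hskew, ← lie_skew (π γ) (π α)]
    simp only [koszul, LinearMap.sub_apply, LinearMap.comp_apply, adl_apply, map_neg]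
    ring
  · rw [sub_eq_zero.mp (hinr α β).2]
    simp only [koszul, LinearMap.comp_apply, hcompat₁]
    abel
  · have h := (hinl X Y).1
    simp only [map_add, map_sub] at h
    rw [← sub_eq_zero, ← h]
    abel
  · have h := LinearMap.congr_fun (hinl X Y).2 Z
    simp [dOm, hcompat₂] at h ⊢
    rw [← hA.neg ⁅N X, Z⁆ Y, ← hA.neg ⁅N Y, Z⁆ X] at h
    linear_combination h
end

section
/- Let g be a finite-dimensional Lie algebra over a field K of characteristic 0 and π a Poisson bivector on g. Equip g* with the Koszul bracket [α,β]_π = (Z ↦ α([πβ,Z]) − β([πα,Z])), and equip E' = g* × g with the Dorfman bracket [(α,X),(β,Y)] = ([α,β]_π, W), where W ∈ g is the unique element with γ(W) = [β,γ]_π(X) − [α,γ]_π(Y) for all γ ∈ g*. Let ω be a 2-form on g and J_ω the endomorphism of E' given by J_ω(α,X) = (ω♭X, 0). Then ω is a complementary form of π (i.e., [ω♭Y,ω♭Z]_π(X) + [ω♭Z,ω♭X]_π(Y) + [ω♭X,ω♭Y]_π(Z) = 0 for all X,Y,Z ∈ g) if and only if the torsion of J_ω with respect to this Dorfman bracket vanishes,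 i.e., [J_ω u, J_ω v] − J_ω([J_ω u, v] + [u, J_ω v] − J_ω[u,v]) = 0 for all u,v ∈ E'. -/
open Module

set_option linter.unusedSectionVars false

variable {K : Type*} [Field K] [CharZero K]
variable {g : Type*} [LieRing g] [LieAlgebra K g] [FiniteDimensional K g]

/-- The Dorfman bracket on `g* × g` associated with the Koszul bracket of a
Poisson bivector `π`:
`[(α,X),(β,Y)] = ([α,β]_π, W)` with `γ(W) = [β,γ]_π(X) - [α,γ]_π(Y)` for all
`γ`, `W` being obtained through the canonical isomorphism `g ≅ g**`. -/
noncomputable def dorfDual (π : Dual K g →ₗ[K] g) (u v : Dual K g × g) : Dual K g × g :=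
  (koszul π u.1 v.1,
    (Module.evalEquiv K g).symm
      (v.1 ∘ₗ ((-adl (K := K) u.2) ∘ₗ π) - Module.Dual.eval K g ⁅π v.1, u.2⁆
        - u.1 ∘ₗ ((-adl (K := K) v.2) ∘ₗ π) + Module.Dual.eval K g ⁅π u.1, v.2⁆))

/-- `J_ω (α, X) = (ω♭ X, 0)` on `g* × g`. -/
def JomD (ω : g →ₗ[K] g →ₗ[K] K) : (Dual K g × g) →ₗ[K] (Dual K g × g) :=
  LinearMap.prod (ω ∘ₗ LinearMap.snd K (Dual K g) g) 0

/-- Torsion of an endomorphism of `g* × g` with respect to the Dorfman bracket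
of the Koszul bracket of `π`. -/
noncomputable def torDD (π : Dual K g →ₗ[K] g)
    (I : (Dual K g × g) →ₗ[K] (Dual K g × g)) (u v : Dual K g × g) :
    Dual K g × g :=
  dorfDual π (I u) (I v)
    - I (dorfDual π (I u) v + dorfDual π u (I v) - I (dorfDual π u v))

/-- The defining property of the `g`-component of the Dorfman bracket on `g* × g`. -/
lemma apply_dorfDual_snd (π : Dual K g →ₗ[K] g) (u v : Dual K g × g) (γ : Dual K g) :
    γ (dorfDual π u v).2 = koszul π v.1 γ u.2 - koszul π u.1 γ v.2 := by
  simp only [dorfDual, Module.apply_evalEquiv_symm_apply, koszul, LinearMap.add_apply,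
    LinearMap.sub_apply, LinearMap.comp_apply, LinearMap.neg_apply, adl_apply,
    Module.Dual.eval_apply, lie_skew]
  ring

lemma koszul_swap (π : Dual K g →ₗ[K] g) (α β : Dual K g) :
    koszul π α β = -koszul π β α := by
  simp [koszul]

lemma torDD_JomD_snd (π : Dual K g →ₗ[K] g) (ω : g →ₗ[K] g →ₗ[K] K) (u v : Dual K g × g) :
    (torDD π (JomD ω) u v).2 = 0 := by
  have h : (dorfDual π (JomD ω u) (JomD ω v)).2 = 0 := by
    rw [← Module.forall_dual_apply_eq_zero_iff K]
    intro γ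
    simp [apply_dorfDual_snd, JomD]
  simp only [torDD, Prod.snd_sub, h]
  simp [JomD]

lemma torDD_JomD_fst_apply (π : Dual K g →ₗ[K] g) (ω : g →ₗ[K] g →ₗ[K] K)
    (hAlt : ∀ X, ω X X = 0) (u v : Dual K g × g) (Z : g) :
    (torDD π (JomD ω) u v).1 Z =
      koszul π (ω v.2) (ω Z) u.2 + koszul π (ω Z) (ω u.2) v.2
        + koszul π (ω u.2) (ω v.2) Z := by
  have hω : ∀ X, ω X Z = -ω Z X := fun X => (LinearMap.IsAlt.neg hAlt Z X).symm
  have h₁ : (JomD ω u).1 = ω u.2 := rfl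
  have h₂ : (JomD ω v).1 = ω v.2 := rfl
  have h : (torDD π (JomD ω) u v).1 Z = koszul π (ω u.2) (ω v.2) Z
      - ω ((dorfDual π (JomD ω u) v).2 + (dorfDual π u (JomD ω v)).2 - 0) Z := rfl
  rw [h, hω, sub_zero, map_add, apply_dorfDual_snd, apply_dorfDual_snd, h₁, h₂,
    koszul_swap π (ω Z) (ω u.2)]
  have h₃ : (JomD ω u).2 = 0 := rfl
  have h₄ : (JomD ω v).2 = 0 := rfl
  rw [h₃, h₄, map_zero, map_zero, LinearMap.neg_apply]
  ring

/-- A 2-form `ω` is a complementary form of a Poisson bivector `π` iff the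
torsion of `J_ω` with respect to the Dorfman bracket on `g* × g` vanishes. -/
theorem complementary_iff_torDD (π : Dual K g →ₗ[K] g)
    (hskew : ∀ α β : Dual K g, α (π β) = -β (π α))
    (hPoisson : ∀ α β γ : Dual K g, α ⁅π β, π γ⁆ + β ⁅π γ, π α⁆ + γ ⁅π α, π β⁆ = 0)
    (ω : g →ₗ[K] g →ₗ[K] K) (hAlt : ∀ X, ω X X = 0) :
    (∀ X Y Z : g,
      koszul π (ω Y) (ω Z) X + koszul π (ω Z) (ω X) Y
        + koszul π (ω X) (ω Y) Z = 0) ↔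
      ∀ u v : Dual K g × g, torDD π (JomD ω) u v = 0 := by
  constructor
  · intro h u v
    refine Prod.ext (LinearMap.ext fun Z => ?_) (torDD_JomD_snd π ω u v)
    rw [torDD_JomD_fst_apply π ω hAlt]
    exact h u.2 v.2 Z
  · intro h X Y Z
    rw [← torDD_JomD_fst_apply π ω hAlt (0, X) (0, Y) Z, h]
    rfl
end

section
/- Let g be a finite-dimensional Lie algebra over a field K of characteristic 0, E = g × g* with the Dorfman bracket [(X,α),(Y,β)] = ([X,Y], Z ↦ α([Y,Z]) − β([X,Z])). Let (ω,N) and (ω',N') be two ΩN structures on g. Then (ω + ω', N + N') is an ΩN structure on g if and only if the following three conditions hold: (a) the Nijenhuis concomitant of N and N' on g vanishes: [NX,N'Y] − N[X,N'Y] − N[N'X,Y] + (N∘N')[X,Y] + [N'X,NY] − N'[X,NY] − N'[NX,Y] + (N'∘N)[X,Y] = 0 for all X,Y ∈ g; (b) N_D(J_ω, J_{N'}) + N_D(J_{ω'}, J_N) = 0, where N_D denotes the Nijenhuis concomitant with respect to the Dorfman bracket on E; (c) (J_ω∘J_{N'} + J_{N'}∘J_ω) + (J_{ω'}∘J_N +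 J_N∘J_{ω'}) = 0. -/
open Module

set_option linter.unusedSectionVars false

variable {K : Type*} [Field K] [CharZero K]
variable {g : Type*} [LieRing g] [LieAlgebra K g] [FiniteDimensional K g]

/-- Nijenhuis concomitant of two endomorphisms of `g × g*` with respect to the
Dorfman bracket. -/
def nconcD (I J : (g × Dual K g) →ₗ[K] (g × Dual K g)) (u v : g × Dual K g) :
    g × Dual K g :=
  dorf (I u) (J v) - I (dorf u (J v)) - I (dorf (J u) v) + (I ∘ₗ J) (dorf u v)
    + dorf (J u) (I v) - J (dorf u (I v)) - J (dorf (I u) v) + (J ∘ₗ I) (dorf u v)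

/-- `(ω, N)` is an ΩN structure on `g`. -/
def IsOmegaN (ω : g →ₗ[K] g →ₗ[K] K) (N : g →ₗ[K] g) : Prop :=
  (∀ X Y Z : g, ω ⁅X, Y⁆ Z + ω ⁅Y, Z⁆ X + ω ⁅Z, X⁆ Y = 0) ∧
  (∀ X Y : g, ⁅N X, N Y⁆ - N ⁅N X, Y⁆ - N ⁅X, N Y⁆ + N (N ⁅X, Y⁆) = 0) ∧
  (∀ X Y : g, ω (N X) Y = ω X (N Y)) ∧
  (∀ X Y Z : g, ω (N ⁅X, Y⁆) Z + ω (N ⁅Y, Z⁆) X + ω (N ⁅Z, X⁆) Y = 0)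

lemma nconcD_Jom_JN_fst (ω : g →ₗ[K] g →ₗ[K] K) (N : g →ₗ[K] g) (u v : g × Dual K g) :
    (nconcD (Jom ω) (JN N) u v).1 = 0 := by
  simp [nconcD, dorf, Jom, JN]

/-- The covector part of the concomitant of `J_ω` and `J_N` for a closed 2-form `ω`. -/
lemma nconcD_Jom_JN_snd (ω : g →ₗ[K] g →ₗ[K] K) (hAlt : ω.IsAlt)
    (hcl : ∀ X Y Z : g, ω ⁅X, Y⁆ Z + ω ⁅Y, Z⁆ X + ω ⁅Z, X⁆ Y = 0)
    (N : g →ₗ[K] g) (u v : g × Dual K g) (Z : g) :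
    (nconcD (Jom ω) (JN N) u v).2 Z
      = ω (N ⁅u.1, v.1⁆) Z + ω ⁅v.1, Z⁆ (N u.1) + ω ⁅Z, u.1⁆ (N v.1) := by
  obtain ⟨X, α⟩ := u
  obtain ⟨Y, β⟩ := v
  have expand : (nconcD (Jom ω) (JN N) (X, α) (Y, β)).2 Z
      = ω X ⁅N Y, Z⁆ - ω ⁅X, N Y⁆ Z - ω ⁅N X, Y⁆ Z + ω (N ⁅X, Y⁆) Z
        - ω Y ⁅N X, Z⁆ - ω Y ⁅X, N Z⁆ + ω X ⁅Y, N Z⁆ - ω ⁅X, Y⁆ (N Z) := by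
    simp [nconcD, dorf, Jom, JN]
    ring
  have skew (A B C : g) : ω A ⁅B, C⁆ = ω ⁅C, B⁆ A := by
    rw [← hAlt.neg, ← lie_skew B C, map_neg, LinearMap.neg_apply, neg_neg]
  have skew' (A B C : g) : ω ⁅A, B⁆ C = -ω ⁅B, A⁆ C := by
    rw [← lie_skew A B, map_neg, LinearMap.neg_apply]
  rw [expand]
  simp only [skew]
  linear_combination -hcl X (N Y) Z - hcl (N X) Y Z - hcl X Y (N Z)
    + skew' (N Y) Z X + skew' (N Z) Y X

/-- Two ΩN structures `(ω, N)` and `(ω', N')` are compatible (their sum is an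
ΩN structure) iff the Nijenhuis concomitant of `N` and `N'` vanishes, the sum
of the mixed Dorfman–Nijenhuis concomitants vanishes, and the sum of the mixed
anti-commutators vanishes. -/
theorem omegaN_compatible_iff (ω ω' : g →ₗ[K] g →ₗ[K] K)
    (hAlt : ∀ X, ω X X = 0) (hAlt' : ∀ X, ω' X X = 0)
    (N N' : g →ₗ[K] g)
    (h : IsOmegaN ω N) (h' : IsOmegaN ω' N') :
    IsOmegaN (ω + ω') (N + N') ↔
      ((∀ X Y : g,
        ⁅N X, N' Y⁆ - N ⁅X, N' Y⁆ - N ⁅N' X, Y⁆ + (N ∘ₗ N') ⁅X, Y⁆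
          + ⁅N' X, N Y⁆ - N' ⁅X, N Y⁆ - N' ⁅N X, Y⁆ + (N' ∘ₗ N) ⁅X, Y⁆ = 0) ∧
      (∀ u v : g × Dual K g,
        nconcD (Jom ω) (JN N') u v + nconcD (Jom ω') (JN N) u v = 0) ∧
      (Jom ω ∘ₗ JN N' + JN N' ∘ₗ Jom ω)
        + (Jom ω' ∘ₗ JN N + JN N ∘ₗ Jom ω') = 0) := by
  obtain ⟨hcl, hN, hsym, hclN⟩ := h
  obtain ⟨hcl', hN', hsym', hclN'⟩ := h'
  have anticomm : (Jom ω ∘ₗ JN N' + JN N' ∘ₗ Jom ω)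
        + (Jom ω' ∘ₗ JN N + JN N ∘ₗ Jom ω') = 0 ↔
      ∀ X Y, ω (N' X) Y + ω' (N X) Y = ω X (N' Y) + ω' X (N Y) := by
    constructor
    · intro hc X Y
      have := congrArg (fun F => (F (X, (0 : Dual K g))).2 Y) hc
      simp [Jom, JN] at this
      linear_combination this
    · intro hc
      refine LinearMap.ext fun u => Prod.ext (by simp [Jom, JN]) (LinearMap.ext fun Y => ?_)
      simp [Jom, JN]
      linear_combination hc u.1 Y
  have conc : (∀ u v : g × Dual K g,
        nconcD (Jom ω) (JN N') u v + nconcD (Jom ω') (JN N) u v = 0) ↔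
      ∀ X Y Z, (ω (N' ⁅X, Y⁆) Z + ω ⁅Y, Z⁆ (N' X) + ω ⁅Z, X⁆ (N' Y))
        + (ω' (N ⁅X, Y⁆) Z + ω' ⁅Y, Z⁆ (N X) + ω' ⁅Z, X⁆ (N Y)) = 0 := by
    constructor
    · intro hb X Y Z
      have := congrArg (fun w => w.2 Z) (hb (X, 0) (Y, 0))
      simpa only [Prod.snd_add, LinearMap.add_apply, nconcD_Jom_JN_snd ω hAlt hcl,
        nconcD_Jom_JN_snd ω' hAlt' hcl', Prod.snd_zero, LinearMap.zero_apply] using this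
    · intro hb u v
      refine Prod.ext (by simp [nconcD_Jom_JN_fst]) (LinearMap.ext fun Z => ?_)
      simpa only [Prod.snd_add, LinearMap.add_apply, nconcD_Jom_JN_snd ω hAlt hcl,
        nconcD_Jom_JN_snd ω' hAlt' hcl', Prod.snd_zero, LinearMap.zero_apply] using hb u.1 v.1 Z
  rw [anticomm, conc]
  simp only [IsOmegaN, LinearMap.add_apply, LinearMap.comp_apply, map_add, add_lie, lie_add]
  constructor
  · rintro ⟨-, hNij, hS, hD⟩
    have hC (X Y : g) : ω (N' X) Y + ω' (N X) Y = ω X (N' Y) + ω' X (N Y) := by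
      linear_combination hS X Y - hsym X Y - hsym' X Y
    refine ⟨fun X Y => ?_, fun X Y Z => ?_, hC⟩
    · linear_combination (norm := abel) hNij X Y - hN X Y - hN' X Y
    · linear_combination hD X Y Z - hclN X Y Z - hclN' X Y Z - hC ⁅Y, Z⁆ X - hC ⁅Z, X⁆ Y
  · rintro ⟨ha, hb, hC⟩
    refine ⟨fun X Y Z => ?_, fun X Y => ?_, fun X Y => ?_, fun X Y Z => ?_⟩
    · linear_combination hcl X Y Z + hcl' X Y Z
    · linear_combination (norm := abel) ha X Y + hN X Y + hN' X Y
    · linear_combination hC X Y + hsym X Y + hsym' X Y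
    · linear_combination hb X Y Z + hclN X Y Z + hclN' X Y Z + hC ⁅Y, Z⁆ X + hC ⁅Z, X⁆ Y
end

section
/- Let g be a finite-dimensional Lie algebra over a field K of characteristic 0 and let (ω,N) and (ω',N') be two ΩN structures on g that are compatible, i.e., such that (ω + ω', N + N') is also an ΩN structure. Then (ω, N') is an ΩN structure if and only if (ω', N) is an ΩN structure. Moreover, if (ω, N') is an ΩN structure, then the four ΩN structures (ω,N), (ω',N'), (ω,N'), (ω',N) are pairwise compatible: the sum of any two of them is again an ΩN structure. -/
set_option linter.unusedSectionVars false

variable {K : Type*} [Field K] [CharZero K]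
variable {g : Type*} [LieRing g] [LieAlgebra K g] [FiniteDimensional K g]

section

variable {ω ω' : g →ₗ[K] g →ₗ[K] K} {N N' : g →ₗ[K] g}

/-- If the mixed pair `(ω, N')` of a compatible couple is ΩN, so is `(ω', N)`. -/
theorem IsOmegaN.cross (h : IsOmegaN ω N) (h' : IsOmegaN ω' N')
    (hsum : IsOmegaN (ω + ω') (N + N')) (hc : IsOmegaN ω N') : IsOmegaN ω' N := by
  obtain ⟨-, hN, hs, hd⟩ := h
  obtain ⟨hω', -, hs', hd'⟩ := h'
  obtain ⟨-, -, hss, hds⟩ := hsum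
  obtain ⟨-, -, hcs, hcd⟩ := hc
  simp only [LinearMap.add_apply, map_add] at hss hds
  refine ⟨hω', hN, fun X Y => ?_, fun X Y Z => ?_⟩
  · linear_combination hss X Y - hs X Y - hs' X Y - hcs X Y
  · linear_combination hds X Y Z - hd X Y Z - hd' X Y Z - hcd X Y Z

/-- Two ΩN structures with the same endomorphism are compatible. -/
theorem IsOmegaN.add_same_endomorphism (h : IsOmegaN ω N) (h' : IsOmegaN ω' N) :
    IsOmegaN (ω + ω') (N + N) := by
  obtain ⟨hω, hN, hs, hd⟩ := h
  obtain ⟨hω', -, hs', hd'⟩ := h'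
  refine ⟨fun X Y Z => ?_, fun X Y => ?_, fun X Y => ?_, fun X Y Z => ?_⟩ <;>
    simp only [LinearMap.add_apply, map_add, add_lie, lie_add]
  · linear_combination hω X Y Z + hω' X Y Z
  · linear_combination (norm := module) (4 : ℤ) • hN X Y
  · linear_combination 2 * hs X Y + 2 * hs' X Y
  · linear_combination 2 * hd X Y Z + 2 * hd' X Y Z

/-- Two ΩN structures with the same form are compatible when the sum of their endomorphisms is
Nijenhuis. -/
theorem IsOmegaN.add_same_form (h : IsOmegaN ω N) (h' : IsOmegaN ω N')
    (hN : ∀ X Y : g, ⁅(N + N') X, (N + N') Y⁆ - (N + N') ⁅(N + N') X, Y⁆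
      - (N + N') ⁅X, (N + N') Y⁆ + (N + N') ((N + N') ⁅X, Y⁆) = 0) :
    IsOmegaN (ω + ω) (N + N') := by
  obtain ⟨hω, -, hs, hd⟩ := h
  obtain ⟨-, -, hs', hd'⟩ := h'
  refine ⟨fun X Y Z => ?_, hN, fun X Y => ?_, fun X Y Z => ?_⟩ <;>
    simp only [LinearMap.add_apply, map_add]
  · linear_combination 2 * hω X Y Z
  · linear_combination 2 * hs X Y + 2 * hs' X Y
  · linear_combination 2 * hd X Y Z + 2 * hd' X Y Z

end

/-- Given two compatible ΩN structures `(ω, N)` and `(ω', N')`, the pair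
`(ω, N')` is an ΩN structure iff `(ω', N)` is; and if one of them (hence both)
is, then the four ΩN structures `(ω,N)`, `(ω',N')`, `(ω,N')`, `(ω',N)` are
pairwise compatible. -/
theorem omegaN_cross_compatible (ω ω' : g →ₗ[K] g →ₗ[K] K)
    (hAlt : ∀ X, ω X X = 0) (hAlt' : ∀ X, ω' X X = 0)
    (N N' : g →ₗ[K] g)
    (h : IsOmegaN ω N) (h' : IsOmegaN ω' N')
    (hsum : IsOmegaN (ω + ω') (N + N')) :
    (IsOmegaN ω N' ↔ IsOmegaN ω' N) ∧
    (IsOmegaN ω N' →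
      IsOmegaN (ω + ω) (N + N') ∧
      IsOmegaN (ω + ω') (N + N) ∧
      IsOmegaN (ω' + ω) (N' + N') ∧
      IsOmegaN (ω' + ω') (N' + N) ∧
      IsOmegaN (ω + ω') (N' + N)) := by
  refine ⟨⟨h.cross h' hsum, h'.cross h (by rwa [add_comm ω' ω, add_comm N' N])⟩, fun hc => ?_⟩
  have hc' : IsOmegaN ω' N := h.cross h' hsum hc
  refine ⟨h.add_same_form hc hsum.2.1, h.add_same_endomorphism hc',
    h'.add_same_endomorphism hc, h'.add_same_form hc' ?_, ?_⟩
  · rw [add_comm N' N]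
    exact hsum.2.1
  · rwa [add_comm N' N]
end

section
/- Let g be a finite-dimensional Lie algebra over a field K of characteristic 0 and (ω,N) an ΩN structure on g. Define the deformed brackets μ_{N^[0]}(X,Y) := [X,Y] and μ_{N^[k+1]}(X,Y) := μ_{N^[k]}(NX,Y) + μ_{N^[k]}(X,NY) − N(μ_{N^[k]}(X,Y)). Then for all n,k ∈ ℕ the 2-form ω_{N^n}, ω_{N^n}(X,Y) = ω(N^n X, Y), is closed with respect to μ_{N^[k]}, i.e., ω_{N^n}(μ_{N^[k]}(X,Y),Z) + ω_{N^n}(μ_{N^[k]}(Y,Z),X) + ω_{N^n}(μ_{N^[k]}(Z,X),Y) = 0 for all X,Y,Z ∈ g. -/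
set_option linter.unusedSectionVars false

variable {K : Type*} [Field K] [CharZero K]
variable {g : Type*} [LieRing g] [LieAlgebra K g] [FiniteDimensional K g]

/-- The `k`-fold deformation `μ_{N^[k]}` of the Lie bracket of `g` by `N`. -/
def mubr (N : g →ₗ[K] g) : ℕ → g → g → g
  | 0, X, Y => ⁅X, Y⁆
  | k + 1, X, Y => mubr N k (N X) Y + mubr N k X (N Y) - N (mubr N k X Y)

/-- A self-adjoint map for `ω` can be moved from the second argument into the power. -/
theorem apply_pow_apply_right (ω : g →ₗ[K] g →ₗ[K] K) (N : g →ₗ[K] g)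
    (hsym : ∀ X Y : g, ω (N X) Y = ω X (N Y)) (n : ℕ) (X Y : g) :
    ω ((N ^ n) X) (N Y) = ω ((N ^ (n + 1)) X) Y := by
  rw [← hsym, pow_succ', Module.End.mul_apply]

/-- If `(ω, N)` is an ΩN structure on `g`, then every 2-form `ω_{N^n}` is closed. -/
theorem omega_pow_closed (ω : g →ₗ[K] g →ₗ[K] K)
    (hcl : ∀ X Y Z : g, ω ⁅X, Y⁆ Z + ω ⁅Y, Z⁆ X + ω ⁅Z, X⁆ Y = 0)
    (N : g →ₗ[K] g)
    (hNij : ∀ X Y : g, ⁅N X, N Y⁆ - N ⁅N X, Y⁆ - N ⁅X, N Y⁆ + N (N ⁅X, Y⁆) = 0)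
    (hsym : ∀ X Y : g, ω (N X) Y = ω X (N Y))
    (hclN : ∀ X Y Z : g, ω (N ⁅X, Y⁆) Z + ω (N ⁅Y, Z⁆) X + ω (N ⁅Z, X⁆) Y = 0) (n : ℕ) :
    ∀ X Y Z : g,
      ω ((N ^ n) ⁅X, Y⁆) Z + ω ((N ^ n) ⁅Y, Z⁆) X + ω ((N ^ n) ⁅Z, X⁆) Y = 0 := by
  induction n using Nat.twoStepInduction with
  | zero => simpa using hcl
  | one => simpa using hclN
  | more n ih₀ ih₁ =>
    intro X Y Z
    have torsion : ∀ X Y Z : g, ω ((N ^ n) ⁅N X, N Y⁆) Z - ω ((N ^ (n + 1)) ⁅N X, Y⁆) Z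
        - ω ((N ^ (n + 1)) ⁅X, N Y⁆) Z + ω ((N ^ (n + 2)) ⁅X, Y⁆) Z = 0 := fun X Y Z => by
      simpa [pow_succ] using congrArg (fun v => ω ((N ^ n) v) Z) (hNij X Y)
    have a₁ := ih₀ (N X) (N Y) Z
    have a₂ := ih₀ (N Y) (N Z) X
    have a₃ := ih₀ (N Z) (N X) Y
    have b₁ := ih₁ (N X) Y Z
    have b₂ := ih₁ (N Y) Z X
    have b₃ := ih₁ (N Z) X Y
    simp only [apply_pow_apply_right ω N hsym] at a₁ a₂ a₃ b₁ b₂ b₃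
    have triple : (3 : K) * (ω ((N ^ (n + 2)) ⁅X, Y⁆) Z + ω ((N ^ (n + 2)) ⁅Y, Z⁆) X
        + ω ((N ^ (n + 2)) ⁅Z, X⁆) Y) = 0 := by
      linear_combination torsion X Y Z + torsion Y Z X + torsion Z X Y - a₁ - a₂ - a₃
        + 2 * (b₁ + b₂ + b₃)
    exact (mul_eq_zero.mp triple).resolve_left three_ne_zero

/-- If `(ω, N)` is an ΩN structure on `g`, then every 2-form `ω_{N^n}` is
closed with respect to every iterated deformed bracket `μ_{N^[k]}`. -/
theorem omega_pow_closed_deformed (ω : g →ₗ[K] g →ₗ[K] K)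
    (hAlt : ∀ X, ω X X = 0)
    (hcl : ∀ X Y Z : g, ω ⁅X, Y⁆ Z + ω ⁅Y, Z⁆ X + ω ⁅Z, X⁆ Y = 0)
    (N : g →ₗ[K] g)
    (hNij : ∀ X Y : g, ⁅N X, N Y⁆ - N ⁅N X, Y⁆ - N ⁅X, N Y⁆ + N (N ⁅X, Y⁆) = 0)
    (hsym : ∀ X Y : g, ω (N X) Y = ω X (N Y))
    (hclN : ∀ X Y Z : g, ω (N ⁅X, Y⁆) Z + ω (N ⁅Y, Z⁆) X + ω (N ⁅Z, X⁆) Y = 0) :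
    ∀ n k : ℕ, ∀ X Y Z : g,
      ω ((N ^ n) (mubr N k X Y)) Z + ω ((N ^ n) (mubr N k Y Z)) X
        + ω ((N ^ n) (mubr N k Z X)) Y = 0 := by
  intro n k
  induction k generalizing n with
  | zero => exact omega_pow_closed ω hcl N hNij hsym hclN n
  | succ k ih =>
    intro X Y Z
    have a₁ := ih n (N X) Y Z
    have a₂ := ih n (N Y) Z X
    have a₃ := ih n (N Z) X Y
    simp only [apply_pow_apply_right ω N hsym] at a₁ a₂ a₃
    have hpow : ∀ v : g, (N ^ n) (N v) = (N ^ (n + 1)) v := fun v => by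
      rw [pow_succ, Module.End.mul_apply]
    simp only [mubr, map_add, map_sub, LinearMap.add_apply, LinearMap.sub_apply, hpow]
    linear_combination a₁ + a₂ + a₃ - 2 * ih (n + 1) X Y Z
end

section
/- Let g be a finite-dimensional Lie algebra over a field K of characteristic 0 and (π,ω) a PΩ structure on g; set N := π∘ω♭. Define the deformed brackets μ_{N^[0]}(X,Y) := [X,Y] and μ_{N^[k+1]}(X,Y) := μ_{N^[k]}(NX,Y) + μ_{N^[k]}(X,NY) − N(μ_{N^[k]}(X,Y)). Then for all m,n,k ∈ ℕ the pair (N^n∘π, ω_{N^m}) is a PΩ structure on g with respect to the bracket μ_{N^[k]}; explicitly: (i) N^n∘π is a bivector (α(N^nπβ) = −β(N^nπα)) which is Poisson with respect to μ_{N^[k]}, i.e., α(μ_{N^[k]}(N^nπβ, N^nπγ)) + β(μ_{N^[k]}(N^nπγ, N^nπα)) + γ(μ_{N^[k]}(N^nπα, N^nπβ)) = 0 for all α,β,γ ∈ g*; (ii) ω_{N^m} is closed with respect to μ_{N^[k]}; and (iii) ω_{N^{2m+n+1}} = (ω_{N^m})_{N'} with N' := (N^n∘π)∘(ω_{N^m})♭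 = N^{n+m+1}, and ω_{N^{2m+n+1}} is closed with respect to μ_{N^[k]}. -/
open Module

set_option linter.unusedSectionVars false

variable {K : Type*} [Field K] [CharZero K]
variable {g : Type*} [LieRing g] [LieAlgebra K g] [FiniteDimensional K g]

section Hierarchy

/-- The deformation of a binary operation `B` by `N`. -/
def deformBracket (N : g →ₗ[K] g) (B : g → g → g) (X Y : g) : g :=
  B (N X) Y + B X (N Y) - N (B X Y)

/-- The form `τ` is closed with respect to `B`. -/
def ClosedFor (τ : g →ₗ[K] g →ₗ[K] K) (B : g → g → g) : Prop :=
  ∀ X Y Z : g, τ (B X Y) Z + τ (B Y Z) X + τ (B Z X) Y = 0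

/-- The map `π` is Poisson with respect to `B`. -/
def PoissonFor (π : Dual K g →ₗ[K] g) (B : g → g → g) : Prop :=
  ∀ α β γ : Dual K g, α (B (π β) (π γ)) + β (B (π γ) (π α)) + γ (B (π α) (π β)) = 0

/-- The Nijenhuis torsion of `N` with respect to `B` vanishes. -/
def NijenhuisFor (N : g →ₗ[K] g) (B : g → g → g) : Prop :=
  ∀ X Y : g, B (N X) (N Y) = N (deformBracket N B X Y)

variable {π : Dual K g →ₗ[K] g} {ω τ : g →ₗ[K] g →ₗ[K] K} {N : g →ₗ[K] g} {B : g → g → g}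

lemma apply_comp_eq_neg (hskew : ∀ α β : Dual K g, α (π β) = -β (π α)) (hN : N = π ∘ₗ ω)
    (α : Dual K g) (X : g) : α (N X) = -ω X (π α) := by
  rw [hN]
  exact hskew α (ω X)

lemma form_comp_symm (hskew : ∀ α β : Dual K g, α (π β) = -β (π α)) (hω : ω.IsAlt)
    (hN : N = π ∘ₗ ω) (X Y : g) : ω (N X) Y = ω X (N Y) := by
  rw [apply_comp_eq_neg hskew hN, ← hω.neg Y (N X), hN]
  rfl

lemma form_comp_pow_symm (h : ∀ X Y, ω (N X) Y = ω X (N Y)) (m : ℕ) (X Y : g) :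
    (ω ∘ₗ (N ^ m : g →ₗ[K] g)) (N X) Y = (ω ∘ₗ (N ^ m : g →ₗ[K] g)) X (N Y) := by
  simp only [LinearMap.comp_apply]
  rw [← h, ← Module.End.mul_apply, ← Module.End.mul_apply, ← pow_succ, ← pow_succ']

lemma pow_comp_skew (hskew : ∀ α β : Dual K g, α (π β) = -β (π α)) (hω : ω.IsAlt)
    (hN : N = π ∘ₗ ω) (n : ℕ) (α β : Dual K g) :
    α ((N ^ n) (π β)) = -β ((N ^ n) (π α)) := by
  induction n generalizing α with
  | zero => exact hskew α β
  | succ n ih =>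
    have hα : α ∘ₗ N = ω (π α) := by
      ext X
      rw [LinearMap.comp_apply, apply_comp_eq_neg hskew hN, hω.neg]
    have hπ : π (α ∘ₗ N) = N (π α) := by
      rw [hα, hN]
      rfl
    have h := ih (α ∘ₗ N)
    rw [hπ, ← Module.End.mul_apply, ← pow_succ] at h
    rw [← h, pow_succ']
    rfl

lemma NijenhuisFor.of_poisson_of_closed (hskew : ∀ α β : Dual K g, α (π β) = -β (π α))
    (hω : ω.IsAlt) (hN : N = π ∘ₗ ω) (hP : PoissonFor π B) (h₀ : ClosedFor ω B)
    (h₁ : ClosedFor (ω ∘ₗ N) B) : NijenhuisFor N B := by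
  intro X Y
  rw [← sub_eq_zero, ← Module.forall_dual_apply_eq_zero_iff K]
  intro α
  have hp := hP α (ω X) (ω Y)
  have hX : π (ω X) = N X := by rw [hN]; rfl
  have hY : π (ω Y) = N Y := by rw [hN]; rfl
  rw [hX, hY] at hp
  have e₁ := h₀ (N Y) (π α) X
  have e₂ := h₀ (π α) (N X) Y
  have e₃ := h₁ X Y (π α)
  simp only [LinearMap.comp_apply] at e₃
  rw [← hω.neg] at hp
  rw [← hω.neg _ Y] at hp
  simp only [deformBracket, map_sub, map_add]
  rw [apply_comp_eq_neg hskew hN, apply_comp_eq_neg hskew hN, apply_comp_eq_neg hskew hN]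
  have s := form_comp_symm hskew hω hN
  rw [← s] at e₁ e₂
  linear_combination hp + e₁ + e₂ - e₃

lemma ClosedFor.deform (hs : ∀ X Y, τ (N X) Y = τ X (N Y)) (h₀ : ClosedFor τ B)
    (h₁ : ClosedFor (τ ∘ₗ N) B) : ClosedFor τ (deformBracket N B) := by
  intro X Y Z
  have e₁ := h₀ (N X) Y Z
  have e₂ := h₀ X (N Y) Z
  have e₃ := h₀ X Y (N Z)
  have e := h₁ X Y Z
  simp only [LinearMap.comp_apply] at e
  rw [← hs] at e₁ e₂ e₃
  simp only [deformBracket, map_sub, map_add, LinearMap.sub_apply, LinearMap.add_apply]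
  linear_combination e₁ + e₂ + e₃ - 2 * e

lemma ClosedFor.comp_comp (hs : ∀ X Y, τ (N X) Y = τ X (N Y)) (hB : NijenhuisFor N B)
    (h₀ : ClosedFor τ B) (h₁ : ClosedFor (τ ∘ₗ N) B) : ClosedFor (τ ∘ₗ N ∘ₗ N) B := by
  intro X Y Z
  have key : ∀ U V W, τ (B (N U) (N V)) W
      = τ (N (B (N U) V)) W + τ (N (B U (N V))) W - τ (N (N (B U V))) W := by
    intro U V W
    rw [hB U V]
    simp only [deformBracket, map_sub, map_add, LinearMap.sub_apply, LinearMap.add_apply]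
  have a₁ := h₀ (N X) (N Y) Z
  have a₂ := h₀ X (N Y) (N Z)
  have a₃ := h₀ (N X) Y (N Z)
  have b₁ := h₁ (N X) Y Z
  have b₂ := h₁ X (N Y) Z
  have b₃ := h₁ X Y (N Z)
  simp only [LinearMap.comp_apply, ← hs] at a₁ a₂ a₃ b₁ b₂ b₃ ⊢
  rw [key] at a₁ a₂ a₃
  refine (mul_eq_zero_iff_left (three_ne_zero : (3 : K) ≠ 0)).1 ?_
  linear_combination 2 * (b₁ + b₂ + b₃) - a₁ - a₂ - a₃

lemma ClosedFor.comp_pow (hs : ∀ X Y, ω (N X) Y = ω X (N Y)) (hB : NijenhuisFor N B)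
    (h₀ : ClosedFor ω B) (h₁ : ClosedFor (ω ∘ₗ N) B) (m : ℕ) :
    ClosedFor (ω ∘ₗ (N ^ m : g →ₗ[K] g)) B := by
  induction m using Nat.twoStepInduction with
  | zero => exact h₀
  | one => rwa [pow_one]
  | more m ih ih' =>
    rw [pow_succ] at ih'
    rw [pow_add, pow_two]
    exact ih.comp_comp (form_comp_pow_symm hs m) hB ih'

lemma PoissonFor.deform (hskew : ∀ α β : Dual K g, α (π β) = -β (π α)) (hω : ω.IsAlt)
    (hN : N = π ∘ₗ ω) (hP : PoissonFor π B) (h₀ : ClosedFor ω B) :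
    PoissonFor π (deformBracket N B) := by
  intro α β γ
  have hπ : ∀ δ : Dual K g, π (ω (π δ)) = N (π δ) := by
    intro δ
    rw [hN]
    rfl
  have e := h₀ (π α) (π β) (π γ)
  have e₁ := hP (ω (π α)) β γ
  have e₂ := hP α (ω (π β)) γ
  have e₃ := hP α β (ω (π γ))
  rw [hπ, ← hω.neg] at e₁ e₂ e₃
  simp only [deformBracket, map_sub, map_add]
  rw [apply_comp_eq_neg hskew hN, apply_comp_eq_neg hskew hN, apply_comp_eq_neg hskew hN]
  linear_combination e₁ + e₂ + e₃ + 2 * e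

lemma mubr_pow (h : ∀ k, NijenhuisFor N (mubr N k)) (k n : ℕ) (X Y : g) :
    mubr N k ((N ^ n) X) ((N ^ n) Y) = (N ^ n) (mubr N (k + n) X Y) := by
  induction n generalizing X Y with
  | zero => rfl
  | succ n ih =>
    have hX : ∀ Z, (N ^ (n + 1)) Z = (N ^ n) (N Z) := fun Z => by rw [pow_succ]; rfl
    rw [hX, hX, hX, ih, h (k + n) X Y]
    rfl

/-- The defining conditions of a PΩ structure persist under iterated deformation. -/
lemma mubr_pOmega (hskew : ∀ α β : Dual K g, α (π β) = -β (π α)) (hω : ω.IsAlt)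
    (hN : N = π ∘ₗ ω) (hP : PoissonFor π (fun X Y : g => ⁅X, Y⁆))
    (h₀ : ClosedFor ω (fun X Y : g => ⁅X, Y⁆))
    (h₁ : ClosedFor (ω ∘ₗ N) (fun X Y : g => ⁅X, Y⁆)) (k : ℕ) :
    PoissonFor π (mubr N k) ∧ ClosedFor ω (mubr N k) ∧ ClosedFor (ω ∘ₗ N) (mubr N k) := by
  induction k with
  | zero => exact ⟨hP, h₀, h₁⟩
  | succ k ih =>
    obtain ⟨hP, h₀, h₁⟩ := ih
    have hs := form_comp_symm hskew hω hN
    have hB := NijenhuisFor.of_poisson_of_closed hskew hω hN hP h₀ h₁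
    exact ⟨hP.deform hskew hω hN h₀, h₀.deform hs h₁,
      h₁.deform (fun X Y => hs (N X) Y) (h₀.comp_comp hs hB h₁)⟩

end Hierarchy

/-- Hierarchy of PΩ structures: if `(π, ω)` is a PΩ structure on `g` and
`N = π ∘ ω♭`, then for all `m, n, k` the pair `(N^n ∘ π, ω_{N^m})` is a PΩ
structure with respect to the deformed bracket `μ_{N^[k]}`. -/
theorem pOmega_hierarchy (π : Dual K g →ₗ[K] g)
    (hskew : ∀ α β : Dual K g, α (π β) = -β (π α))
    (hPoisson : ∀ α β γ : Dual K g, α ⁅π β, π γ⁆ + β ⁅π γ, π α⁆ + γ ⁅π α, π β⁆ = 0)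
    (ω : g →ₗ[K] g →ₗ[K] K) (hAlt : ∀ X, ω X X = 0)
    (hcl : ∀ X Y Z : g, ω ⁅X, Y⁆ Z + ω ⁅Y, Z⁆ X + ω ⁅Z, X⁆ Y = 0)
    (N : g →ₗ[K] g) (hNdef : N = π ∘ₗ ω)
    (hclN : ∀ X Y Z : g, ω (N ⁅X, Y⁆) Z + ω (N ⁅Y, Z⁆) X + ω (N ⁅Z, X⁆) Y = 0) :
    ∀ m n k : ℕ,
      -- (i) `N^n ∘ π` is a bivector, Poisson with respect to `μ_{N^[k]}`
      (∀ α β : Dual K g, α (((N ^ n) ∘ₗ π) β) = -β (((N ^ n) ∘ₗ π) α)) ∧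
      (∀ α β γ : Dual K g,
        α (mubr N k (((N ^ n) ∘ₗ π) β) (((N ^ n) ∘ₗ π) γ))
          + β (mubr N k (((N ^ n) ∘ₗ π) γ) (((N ^ n) ∘ₗ π) α))
          + γ (mubr N k (((N ^ n) ∘ₗ π) α) (((N ^ n) ∘ₗ π) β)) = 0) ∧
      -- (ii) `ω_{N^m}` is closed with respect to `μ_{N^[k]}`
      (∀ X Y Z : g,
        ω ((N ^ m) (mubr N k X Y)) Z + ω ((N ^ m) (mubr N k Y Z)) X
          + ω ((N ^ m) (mubr N k Z X)) Y = 0) ∧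
      -- (iii) `(N^n ∘ π) ∘ (ω_{N^m})♭ = N^{n+m+1}`, so
      -- `(ω_{N^m})_{N^{n+m+1}} = ω_{N^{2m+n+1}}`, and the latter is closed
      -- with respect to `μ_{N^[k]}`
      (((N ^ n) ∘ₗ π ∘ₗ (ω ∘ₗ (N ^ m : g →ₗ[K] g)) : g →ₗ[K] g)
          = N ^ (n + m + 1)) ∧
      (∀ X Y : g,
        ω ((N ^ (2 * m + n + 1)) X) Y = ω ((N ^ m) ((N ^ (n + m + 1)) X)) Y) ∧
      (∀ X Y Z : g,
        ω ((N ^ (2 * m + n + 1)) (mubr N k X Y)) Z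
          + ω ((N ^ (2 * m + n + 1)) (mubr N k Y Z)) X
          + ω ((N ^ (2 * m + n + 1)) (mubr N k Z X)) Y = 0) := by
  have hω : ω.IsAlt := hAlt
  have hk := mubr_pOmega hskew hω hNdef hPoisson hcl hclN
  have hB : ∀ k, NijenhuisFor N (mubr N k) := fun k =>
    NijenhuisFor.of_poisson_of_closed hskew hω hNdef (hk k).1 (hk k).2.1 (hk k).2.2
  have hclosed : ∀ m k, ClosedFor (ω ∘ₗ (N ^ m : g →ₗ[K] g)) (mubr N k) := fun m k =>
    (hk k).2.1.comp_pow (form_comp_symm hskew hω hNdef) (hB k) (hk k).2.2 m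
  intro m n k
  refine ⟨pow_comp_skew hskew hω hNdef n, ?_, hclosed m k, ?_, ?_, hclosed (2 * m + n + 1) k⟩
  · intro α β γ
    simp only [LinearMap.comp_apply, mubr_pow hB]
    cases n with
    | zero => exact (hk k).1 α β γ
    | succ n =>
      have h := hclosed n (k + (n + 1)) (π α) (π β) (π γ)
      simp only [LinearMap.comp_apply] at h
      simp only [pow_succ', Module.End.mul_apply, apply_comp_eq_neg hskew hNdef]
      linear_combination -h
  · have h : (N ^ n) ∘ₗ π ∘ₗ (ω ∘ₗ (N ^ m : g →ₗ[K] g)) = N ^ n * (N * N ^ m) := by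
      rw [show N * N ^ m = (π ∘ₗ ω) * N ^ m by rw [← hNdef]]
      rfl
    rw [h, ← pow_succ', ← pow_add, add_assoc]
  · intro X Y
    rw [← Module.End.mul_apply, ← pow_add]
    congr 4
    ring
end
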